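/- arXiv:1705.04160 — 3 statements merged into one kernel-verified Lean document; each statement's English description precedes it below -/
import Mathlib

section
/- Let n ∈ {1,2,3} and let α_0, α_1, β_0, β_1, γ_0, …, γ_{n−1} be real numbers, not all zero, and define on (0,∞) the function F(h) = h(α_0 + α_1 h) + √(h(4+h)) (β_0 + β_1 h) + (Σ_{k=0}^{n−1} γ_k h^k) · ln((2 + h + √(h(4+h)))/2). Then F has at most n+3 zeros in (0,∞). -/
open Real

/-- Rolle's theorem for finite sets of zeros: between `k + 1` zeros of `f` in an interval there are
at least `k` zeros of its derivative. -/
theorem exists_finset_deriv_zeros {f f' : ℝ → ℝ} {S : Set ℝ} (hS : S.OrdConnected)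
    (hf : ContinuousOn f S) (hf' : ∀ x ∈ interior S, HasDerivAt f (f' x) x)
    (T : Finset ℝ) (hT : ∀ x ∈ T, x ∈ S ∧ f x = 0) :
    ∃ U : Finset ℝ, (∀ x ∈ U, x ∈ interior S ∧ f' x = 0) ∧ T.card ≤ U.card + 1 := by
  classical
  have key : ∀ x ∈ T, ∀ y ∈ T, x < y → ∃ z ∈ Set.Ioo x y, z ∈ interior S ∧ f' z = 0 := by
    intro x hx y hy hxy
    have hsub : Set.Icc x y ⊆ S := hS.out (hT x hx).1 (hT y hy).1
    have hint : Set.Ioo x y ⊆ interior S :=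
      interior_maximal (Set.Ioo_subset_Icc_self.trans hsub) isOpen_Ioo
    obtain ⟨z, hz, hz0⟩ := exists_hasDerivAt_eq_zero hxy (hf.mono hsub)
      ((hT x hx).2.trans (hT y hy).2.symm) (fun z hz => hf' z (hint hz))
    exact ⟨z, hz, hint hz, hz0⟩
  choose! z hz using key
  refine ⟨((T ×ˢ T).filter (fun p => p.1 < p.2)).image (fun p => z p.1 p.2), ?_, ?_⟩
  · intro w hw
    simp only [Finset.mem_image, Finset.mem_filter, Finset.mem_product] at hw
    obtain ⟨p, ⟨⟨h1, h2⟩, h3⟩, rfl⟩ := hw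
    exact (hz _ h1 _ h2 h3).2
  · refine Finset.card_le_of_interleaved fun x hx y hy hxy _ => ?_
    refine ⟨z x y, ?_, (hz x hx y hy hxy).1⟩
    simp only [Finset.mem_image, Finset.mem_filter, Finset.mem_product]
    exact ⟨(x, y), ⟨⟨hx, hy⟩, hxy⟩, rfl⟩

theorem inv_sqrt_sq_mul {h : ℝ} (hh : 0 < h) : (√(h * (4 + h)))⁻¹ ^ 2 * (h * (4 + h)) = 1 := by
  have hp : 0 < h * (4 + h) := by positivity
  rw [inv_pow, Real.sq_sqrt hp.le, inv_mul_cancel₀ hp.ne']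

theorem hasDerivAt_sqrt_mul_four_add {h : ℝ} (hh : 0 < h) :
    HasDerivAt (fun x : ℝ => √(x * (4 + x))) ((h + 2) * (√(h * (4 + h)))⁻¹) h := by
  have hp : 0 < h * (4 + h) := by positivity
  have hq : HasDerivAt (fun x : ℝ => x * (4 + x)) (1 * (4 + h) + h * 1) h :=
    (hasDerivAt_id' h).mul ((hasDerivAt_id' h).const_add 4)
  convert hq.sqrt hp.ne' using 1
  have := (Real.sqrt_pos.2 hp).ne'
  field_simp
  ring

theorem hasDerivAt_inv_sqrt_mul_four_add {h : ℝ} (hh : 0 < h) :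
    HasDerivAt (fun x : ℝ => (√(x * (4 + x)))⁻¹) (-(h + 2) * (√(h * (4 + h)))⁻¹ ^ 3) h := by
  have hs := (Real.sqrt_pos.2 (by positivity : 0 < h * (4 + h))).ne'
  refine ((hasDerivAt_sqrt_mul_four_add hh).inv hs).congr_deriv ?_
  field_simp

theorem hasDerivAt_log_add_sqrt {h : ℝ} (hh : 0 < h) :
    HasDerivAt (fun x : ℝ => Real.log ((2 + x + √(x * (4 + x))) / 2)) (√(h * (4 + h)))⁻¹ h := by
  have hs := Real.sqrt_pos.2 (by positivity : 0 < h * (4 + h))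
  have hd : HasDerivAt (fun x : ℝ => (2 + x + √(x * (4 + x))) / 2)
      ((1 + (h + 2) * (√(h * (4 + h)))⁻¹) / 2) h :=
    (((hasDerivAt_id' h).const_add 2).add (hasDerivAt_sqrt_mul_four_add hh)).div_const 2
  refine (hd.log (by positivity)).congr_deriv ?_
  field_simp
  ring

/-- The numerator of the third derivative of
`h(a₀ + a₁h) + √(h(4+h))(b₀ + b₁h) + (c₀ + c₁h + c₂h²) ln((2 + h + √(h(4+h)))/2)`
over the denominator `√(h(4+h)) ^ 5`. -/
noncomputable def thirdDerivNumerator (b0 b1 c0 c1 c2 : ℝ) : Polynomial ℝ :=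
  .C (24 * b0 + 12 * c0) + .C (12 * b0 - 24 * b1 + 8 * c0 - 12 * c1) * .X
    + .C (2 * c0 - 10 * c1 + 60 * c2) * .X ^ 2 + .C (20 * c2 - c1) * .X ^ 3
    + .C (2 * c2) * .X ^ 4

theorem thirdDerivNumerator_eq_zero {b0 b1 c0 c1 c2 : ℝ}
    (h : thirdDerivNumerator b0 b1 c0 c1 c2 = 0) :
    b0 = 0 ∧ b1 = 0 ∧ c0 = 0 ∧ c1 = 0 ∧ c2 = 0 := by
  have hc : ∀ k, (thirdDerivNumerator b0 b1 c0 c1 c2).coeff k = 0 := by simp [h]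
  have h0 := hc 0
  have h1 := hc 1
  have h2 := hc 2
  have h3 := hc 3
  have h4 := hc 4
  simp only [thirdDerivNumerator, Polynomial.coeff_add, Polynomial.coeff_C_mul,
    Polynomial.coeff_X, Polynomial.coeff_C, Polynomial.coeff_X_pow] at h0 h1 h2 h3 h4
  norm_num at h0 h1 h2 h3 h4
  refine ⟨?_, ?_, ?_, ?_, ?_⟩ <;> linarith

theorem card_zeros_le_natDegree_add_two (a0 a1 b0 b1 c0 c1 c2 : ℝ)
    (hP : thirdDerivNumerator b0 b1 c0 c1 c2 ≠ 0) (T : Finset ℝ)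
    (hT : ∀ h ∈ T, 0 < h ∧ h * (a0 + a1 * h) + √(h * (4 + h)) * (b0 + b1 * h)
      + (c0 + c1 * h + c2 * h ^ 2) * Real.log ((2 + h + √(h * (4 + h))) / 2) = 0) :
    T.card ≤ (thirdDerivNumerator b0 b1 c0 c1 c2).natDegree + 2 := by
  set s : ℝ → ℝ := fun x => √(x * (4 + x)) with hs
  set u : ℝ → ℝ := fun x => (√(x * (4 + x)))⁻¹ with hu
  set L : ℝ → ℝ := fun x => Real.log ((2 + x + √(x * (4 + x))) / 2) with hL
  set B : ℝ → ℝ := fun x => b0 + b1 * x with hB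
  set G : ℝ → ℝ := fun x => c0 + c1 * x + c2 * x ^ 2 with hG
  set F0 : ℝ → ℝ := fun x => x * (a0 + a1 * x) + s x * B x + G x * L x with hF0
  set F1 : ℝ → ℝ := fun x => a0 + 2 * a1 * x + ((x + 2) * B x * u x + b1 * s x)
    + ((c1 + 2 * c2 * x) * L x + G x * u x) with hF1
  set F2 : ℝ → ℝ := fun x => 2 * a1 + (2 * b1 * (x + 2) * u x - 4 * B x * u x ^ 3)
    + (2 * c2 * L x + 2 * (c1 + 2 * c2 * x) * u x - (x + 2) * G x * u x ^ 3) with hF2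
  set F3 : ℝ → ℝ := fun x => (thirdDerivNumerator b0 b1 c0 c1 c2).eval x * u x ^ 5 with hF3
  have ds : ∀ x, 0 < x → HasDerivAt s ((x + 2) * u x) x := fun x => hasDerivAt_sqrt_mul_four_add
  have du : ∀ x, 0 < x → HasDerivAt u (-(x + 2) * u x ^ 3) x :=
    fun x => hasDerivAt_inv_sqrt_mul_four_add
  have dL : ∀ x, 0 < x → HasDerivAt L (u x) x := fun x => hasDerivAt_log_add_sqrt
  have uq : ∀ x, 0 < x → u x ^ 2 * (x * (4 + x)) = 1 := fun x => inv_sqrt_sq_mul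
  have dlin : ∀ p q x : ℝ, HasDerivAt (fun y => p + q * y) q x := fun p q x => by
    simpa using ((hasDerivAt_id' x).const_mul q).const_add p
  have dB : ∀ x, HasDerivAt B b1 x := dlin b0 b1
  have dG : ∀ x, HasDerivAt G (c1 + 2 * c2 * x) x := fun x => by
    refine ((dlin c0 c1 x).add (((hasDerivAt_id' x).pow 2).const_mul c2)).congr_deriv ?_
    norm_num
    ring
  have dx2 : ∀ x : ℝ, HasDerivAt (fun y => y + 2) 1 x := fun x => (hasDerivAt_id' x).add_const 2
  have d0 : ∀ x, 0 < x → HasDerivAt F0 (F1 x) x := by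
    intro x hx
    refine ((((hasDerivAt_id' x).mul (dlin a0 a1 x)).add ((ds x hx).mul (dB x))).add
      ((dG x).mul (dL x hx))).congr_deriv ?_
    simp only [hF1]
    ring
  have d1 : ∀ x, 0 < x → HasDerivAt F1 (F2 x) x := by
    intro x hx
    refine (((dlin a0 (2 * a1) x).add ((((dx2 x).mul (dB x)).mul (du x hx)).add
      ((ds x hx).const_mul b1))).add
      (((dlin c1 (2 * c2) x).mul (dL x hx)).add ((dG x).mul (du x hx)))).congr_deriv ?_
    simp only [hF2, Pi.mul_apply]
    linear_combination (-B x * u x) * uq x hx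
  have d2 : ∀ x, 0 < x → HasDerivAt F2 (F3 x) x := by
    intro x hx
    refine ((((((dx2 x).const_mul (2 * b1)).mul (du x hx)).sub
      (((dB x).const_mul 4).mul ((du x hx).pow 3))).const_add (2 * a1)).add
      ((((dL x hx).const_mul (2 * c2)).add
        (((dlin c1 (2 * c2) x).const_mul 2).mul (du x hx))).sub
        (((dx2 x).mul (dG x)).mul ((du x hx).pow 3)))).congr_deriv ?_
    simp only [hF3, thirdDerivNumerator, Pi.mul_apply, Pi.pow_apply, Polynomial.eval_add,
      Polynomial.eval_mul, Polynomial.eval_pow, Polynomial.eval_C, Polynomial.eval_X]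
    push_cast
    simp only [hB, hG]
    linear_combination (-(2 * b1 + 6 * c2) * u x * (u x ^ 2 * (x * (4 + x)) + 1)
      - (-2 * b1 * (x + 2) ^ 2 - 4 * b1 - 3 * (c1 + 2 * c2 * x) * (x + 2)
        - (c0 + c1 * x + c2 * x ^ 2)) * u x ^ 3) * uq x hx
  have hint : interior (Set.Ioi (0 : ℝ)) = Set.Ioi 0 := isOpen_Ioi.interior_eq
  have c0' : ContinuousOn F0 (Set.Ici 0) := by
    simp only [hF0, hs, hB, hG, hL]
    refine ContinuousOn.add (by fun_prop) (ContinuousOn.mul (by fun_prop) ?_)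
    refine ContinuousOn.log (by fun_prop) fun x hx => ?_
    have : 0 ≤ x := hx
    positivity
  obtain ⟨U1, hU1, hc1⟩ := exists_finset_deriv_zeros (f := F0) (f' := F1) Set.ordConnected_Ici c0'
    (by simpa using d0) (insert 0 T) (by
      intro x hx
      rcases Finset.mem_insert.1 hx with rfl | hx
      · simp [hF0, hs, hL]
      · exact ⟨(hT x hx).1.le, (hT x hx).2⟩)
  obtain ⟨U2, hU2, hc2⟩ := exists_finset_deriv_zeros (f := F1) (f' := F2) Set.ordConnected_Ioi
    (fun x hx => (d1 x hx).continuousAt.continuousWithinAt) (by simpa using d1) U1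
    (by simpa using hU1)
  obtain ⟨U3, hU3, hc3⟩ := exists_finset_deriv_zeros (f := F2) (f' := F3) Set.ordConnected_Ioi
    (fun x hx => (d2 x hx).continuousAt.continuousWithinAt) (by simpa using d2) U2
    (by simpa using hU2)
  have h0 : (0 : ℝ) ∉ T := fun h => (hT 0 h).1.false
  rw [Finset.card_insert_of_notMem h0] at hc1
  have hc4 : U3.card ≤ (thirdDerivNumerator b0 b1 c0 c1 c2).natDegree := by
    refine Polynomial.card_le_degree_of_subset_roots fun x hx => ?_
    obtain ⟨hx0, hx1⟩ := hU3 x hx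
    rw [hint] at hx0
    rw [Polynomial.mem_roots hP]
    have hux : u x ≠ 0 := fun h => by simpa [h] using uq x hx0
    exact (mul_eq_zero.1 hx1).resolve_right (pow_ne_zero _ hux)
  omega

theorem card_zeros_mul_linear_le_one {a0 a1 : ℝ} (ha : ¬ (a0 = 0 ∧ a1 = 0)) (T : Finset ℝ)
    (hT : ∀ h ∈ T, 0 < h ∧ h * (a0 + a1 * h) = 0) : T.card ≤ 1 := by
  refine Finset.card_le_one.2 fun x hx y hy => ?_
  have hx' := (mul_eq_zero.1 (hT x hx).2).resolve_left (hT x hx).1.ne'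
  have hy' := (mul_eq_zero.1 (hT y hy).2).resolve_left (hT y hy).1.ne'
  have ha1 : a1 ≠ 0 := by
    rintro rfl
    exact ha ⟨by simpa using hx', rfl⟩
  exact mul_left_cancel₀ ha1 (by linarith)

theorem card_zeros_le_add_two {a0 a1 b0 b1 c0 c1 c2 : ℝ}
    (hne : ¬ (a0 = 0 ∧ a1 = 0 ∧ b0 = 0 ∧ b1 = 0 ∧ c0 = 0 ∧ c1 = 0 ∧ c2 = 0)) {m : ℕ}
    (hm : (thirdDerivNumerator b0 b1 c0 c1 c2).natDegree ≤ m) (T : Finset ℝ)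
    (hT : ∀ h ∈ T, 0 < h ∧ h * (a0 + a1 * h) + √(h * (4 + h)) * (b0 + b1 * h)
      + (c0 + c1 * h + c2 * h ^ 2) * Real.log ((2 + h + √(h * (4 + h))) / 2) = 0) :
    T.card ≤ m + 2 := by
  by_cases hP : thirdDerivNumerator b0 b1 c0 c1 c2 = 0
  · obtain ⟨rfl, rfl, rfl, rfl, rfl⟩ := thirdDerivNumerator_eq_zero hP
    have := card_zeros_mul_linear_le_one (a0 := a0) (a1 := a1) (by simpa using hne) T
      (fun h hh => by simpa using hT h hh)
    omega
  · exact (card_zeros_le_natDegree_add_two a0 a1 b0 b1 c0 c1 c2 hP T hT).trans (by omega)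

/-- Let `n ∈ {1,2,3}` and let `α_0, α_1, β_0, β_1, γ_0,…,γ_{n−1}` be
reals, not all zero. Then
`F(h) = h(α_0 + α_1 h) + √(h(4+h))(β_0 + β_1 h)
  + (Σ_{k=0}^{n−1} γ_k h^k) ln((2 + h + √(h(4+h)))/2)`
has at most `n+3` zeros in `(0,∞)`. -/
theorem stmt13 (n : ℕ) (hn : n = 1 ∨ n = 2 ∨ n = 3)
    (α0 α1 β0 β1 : ℝ) (γ : ℕ → ℝ)
    (hne : ¬ (α0 = 0 ∧ α1 = 0 ∧ β0 = 0 ∧ β1 = 0 ∧ ∀ k < n, γ k = 0)) :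
    ∀ T : Finset ℝ,
      (∀ h ∈ T, h ∈ Set.Ioi (0 : ℝ) ∧
        h * (α0 + α1 * h) + Real.sqrt (h * (4 + h)) * (β0 + β1 * h)
          + (∑ k ∈ Finset.range n, γ k * h ^ k) *
              Real.log ((2 + h + Real.sqrt (h * (4 + h))) / 2) = 0) →
      T.card ≤ n + 3 := by
  intro T hT
  rcases hn with rfl | rfl | rfl
  · refine card_zeros_le_add_two (m := 2) (a0 := α0) (a1 := α1) (b0 := β0) (b1 := β1) (c0 := γ 0)
      (c1 := 0) (c2 := 0) (fun h => hne ?_) ?_ T fun h hh => ?_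
    · obtain ⟨h1, h2, h3, h4, h5, -⟩ := h
      exact ⟨h1, h2, h3, h4, fun k hk => by interval_cases k; exact h5⟩
    · simp only [thirdDerivNumerator, mul_zero, sub_zero, add_zero, map_zero, zero_mul]
      compute_degree
    · simpa [Finset.sum_range_succ] using hT h hh
  · refine card_zeros_le_add_two (m := 3) (a0 := α0) (a1 := α1) (b0 := β0) (b1 := β1) (c0 := γ 0)
      (c1 := γ 1) (c2 := 0) (fun h => hne ?_) ?_ T fun h hh => ?_
    · obtain ⟨h1, h2, h3, h4, h5, h6, -⟩ := h
      exact ⟨h1, h2, h3, h4, fun k hk => by interval_cases k <;> assumption⟩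
    · simp only [thirdDerivNumerator, mul_zero, add_zero, map_zero, zero_mul]
      compute_degree
    · simpa [Finset.sum_range_succ] using hT h hh
  · refine card_zeros_le_add_two (m := 4) (a0 := α0) (a1 := α1) (b0 := β0) (b1 := β1) (c0 := γ 0)
      (c1 := γ 1) (c2 := γ 2) (fun h => hne ?_) ?_ T fun h hh => ?_
    · obtain ⟨h1, h2, h3, h4, h5, h6, h7⟩ := h
      exact ⟨h1, h2, h3, h4, fun k hk => by interval_cases k <;> assumption⟩
    · rw [thirdDerivNumerator]
      compute_degree
    · simpa [Finset.sum_range_succ] using hT h hh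
end

section
/- Let n ≥ 3 be an integer and let α_{−2}, α_{−1}, α_0, α_1, …, α_{n−2}, β_0, …, β_{n−1}, γ_0, γ_1 be real numbers, not all zero, where in addition γ_1 = 0 if n ∈ {3,4}. Define on (0,∞) the function F(h) = h(α_{−2} + α_{−1} h + α_0 h²) + h(4+h) Σ_{i=1}^{n−2} α_i (2+h)^{2i} + √(h(4+h)) Σ_{i=0}^{n−1} β_i (2+h)^{2i} + (2+h)(γ_0 + γ_1 (2+h)²) · ln((2 + h + √(h(4+h)))/2). Then F has at most 2n+2 zeros in (0,∞). -/
open Real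

/-- **Rolle's theorem for finite sets of zeros**: `m` zeros of `f` in an interval yield at least
`m - 1` zeros of `deriv f` in its interior. -/
theorem exists_finset_deriv_eq_zero {I : Set ℝ} (hI : I.OrdConnected) {f : ℝ → ℝ}
    (hf : ContinuousOn f I) (T : Finset ℝ) (hTI : ∀ x ∈ T, x ∈ I) (hT : ∀ x ∈ T, f x = 0) :
    ∃ S : Finset ℝ, (∀ x ∈ S, x ∈ interior I ∧ deriv f x = 0) ∧ T.card ≤ S.card + 1 := by
  obtain hm | ⟨m, hm⟩ : T.card = 0 ∨ ∃ m, T.card = m + 1 := by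
    cases h : T.card <;> simp
  · exact ⟨∅, by simp, by simp [hm]⟩
  let t : Fin (m + 1) ↪o ℝ := T.orderEmbOfFin hm
  have ht (i) : t i ∈ T := T.orderEmbOfFin_mem hm i
  have hroot (i : Fin m) : ∃ x ∈ Set.Ioo (t i.castSucc) (t i.succ), deriv f x = 0 :=
    exists_deriv_eq_zero (t.strictMono i.castSucc_lt_succ)
      (hf.mono (hI.out (hTI _ (ht _)) (hTI _ (ht _)))) (by rw [hT _ (ht _), hT _ (ht _)])
  choose ξ hξ hξ0 using hroot
  have hmono : StrictMono ξ := by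
    intro i j hij
    have hle : t i.succ ≤ t j.castSucc := t.monotone (by simpa [Fin.le_def] using hij)
    exact (hξ i).2.trans_le (hle.trans (hξ j).1.le)
  refine ⟨Finset.univ.image ξ, fun x hx => ?_, ?_⟩
  · obtain ⟨i, -, rfl⟩ := Finset.mem_image.1 hx
    refine ⟨?_, hξ0 i⟩
    exact interior_mono (hI.out (hTI _ (ht _)) (hTI _ (ht _))) (by rw [interior_Icc]; exact hξ i)
  · rw [Finset.card_image_of_injective _ hmono.injective, hm]; simp

theorem le_analyticOrderAt_deriv {f : ℝ → ℝ} {p : ℝ} {k : ℕ} (hf : AnalyticAt ℝ f p)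
    (h : ((k + 1 : ℕ) : ℕ∞) ≤ analyticOrderAt f p) : (k : ℕ∞) ≤ analyticOrderAt (deriv f) p := by
  rw [natCast_le_analyticOrderAt_iff_iteratedDeriv_eq_zero hf] at h
  rw [natCast_le_analyticOrderAt_iff_iteratedDeriv_eq_zero hf.deriv]
  intro i hi
  rw [← iteratedDeriv_succ']
  exact h _ (by omega)

theorem le_analyticOrderAt_mul_deriv {f g h : ℝ → ℝ} {p : ℝ} {k : ℕ} (hf : AnalyticAt ℝ f p)
    (hg : AnalyticAt ℝ g p) (hh : h =ᶠ[nhds p] fun x => g x * deriv f x)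
    (hk : ((k + 1 : ℕ) : ℕ∞) ≤ analyticOrderAt f p) : (k : ℕ∞) ≤ analyticOrderAt h p := by
  rw [analyticOrderAt_congr hh]
  change _ ≤ analyticOrderAt (g * deriv f) p
  rw [analyticOrderAt_mul hg hf.deriv]
  exact (le_analyticOrderAt_deriv hf hk).trans le_add_self

/-- If in a sequence `f 0, f 1, …` of analytic functions no nontrivial combination of the first
`k` functions has a zero of order `k`, for every `k ≤ N`, then a nontrivial combination of the
first `N` functions has fewer than `N` zeros. -/
theorem card_zeros_lt_of_order_lt (N : ℕ) : ∀ (I : Set ℝ) (_ : I.OrdConnected) (f : ℕ → ℝ → ℝ)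
    (_ : ∀ i, AnalyticOnNhd ℝ (f i) I) (_ : ∀ x ∈ I, f 0 x ≠ 0)
    (_ : ∀ k < N, ∀ p ∈ interior I, ∀ c : ℕ → ℝ,
      ((k + 1 : ℕ) : ℕ∞) ≤ analyticOrderAt (fun x => ∑ i ∈ Finset.range (k + 1), c i * f i x) p →
        ∀ i ≤ k, c i = 0)
    (c : ℕ → ℝ) (_ : ∃ i < N, c i ≠ 0) (T : Finset ℝ)
    (_ : ∀ x ∈ T, x ∈ I ∧ ∑ i ∈ Finset.range N, c i * f i x = 0), T.card < N := by
  induction N with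
  | zero => rintro - - - - - - - ⟨i, hi, -⟩; omega
  | succ N ih =>
    intro I hI f hf hf0 hloc c hc T hT
    by_cases hc' : ∃ i < N, c (i + 1) ≠ 0
    swap
    · push Not at hc'
      have hc0 : c 0 ≠ 0 := by
        obtain ⟨i, hi, h⟩ := hc
        rcases i with _ | i
        · exact h
        · exact absurd (hc' i (by omega)) h
      have : T = ∅ := by
        refine Finset.eq_empty_of_forall_notMem fun x hx => ?_
        obtain ⟨hxI, h⟩ := hT x hx
        rw [Finset.sum_range_succ', Finset.sum_eq_zero, zero_add] at h
        · exact (mul_ne_zero hc0 (hf0 x hxI)) h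
        · intro i hi
          rw [hc' i (Finset.mem_range.1 hi), zero_mul]
      simp [this]
    set g : ℕ → ℝ → ℝ := fun i => deriv (fun x => f (i + 1) x / f 0 x) with hg
    have hquot (i) : AnalyticOnNhd ℝ (fun x => f (i + 1) x / f 0 x) I :=
      fun x hx => (hf _ x hx).div (hf 0 x hx) (hf0 x hx)
    have hga (i) : AnalyticOnNhd ℝ (g i) I := fun x hx => (hquot i x hx).deriv
    have hderiv (M : ℕ) (d : ℕ → ℝ) (x : ℝ) (hx : x ∈ I) :
        deriv (fun x => ∑ i ∈ Finset.range M, d i * (f (i + 1) x / f 0 x)) x =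
          ∑ i ∈ Finset.range M, d i * g i x := by
      rw [deriv_fun_sum fun i _ => ((hquot i x hx).differentiableAt.const_mul _)]
      exact Finset.sum_congr rfl fun i _ => deriv_const_mul _ (hquot i x hx).differentiableAt
    have hlocg : ∀ k < N, ∀ p ∈ interior I, ∀ d : ℕ → ℝ,
        ((k + 1 : ℕ) : ℕ∞) ≤
            analyticOrderAt (fun x => ∑ i ∈ Finset.range (k + 1), d i * g i x) p →
          ∀ i ≤ k, d i = 0 := by
      intro k hk p hp d hd
      have hpI := interior_subset hp
      set G : ℝ → ℝ := fun x => ∑ i ∈ Finset.range (k + 1), d i * (f (i + 1) x / f 0 x) with hG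
      have hGa : AnalyticAt ℝ G p :=
        Finset.analyticAt_fun_sum _ fun i _ => analyticAt_const.mul (hquot i p hpI)
      have hGd : deriv G =ᶠ[nhds p] fun x => ∑ i ∈ Finset.range (k + 1), d i * g i x := by
        filter_upwards [isOpen_interior.mem_nhds hp] with x hx
        exact hderiv _ _ x (interior_subset hx)
      rw [← analyticOrderAt_congr hGd] at hd
      have h1 : ((k + 1 + 1 : ℕ) : ℕ∞) ≤ analyticOrderAt (fun x => G x - G p) p := by
        rw [← hGa.analyticOrderAt_deriv_add_one]
        push_cast at hd ⊢
        gcongr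
      let e : ℕ → ℝ := fun i => Nat.casesOn i (-G p) d
      have h2 : (fun x => ∑ i ∈ Finset.range (k + 1 + 1), e i * f i x) =ᶠ[nhds p]
          f 0 * fun x => G x - G p := by
        filter_upwards [isOpen_interior.mem_nhds hp] with x hx
        have hx0 := hf0 x (interior_subset hx)
        have h4 : ∑ i ∈ Finset.range (k + 1), d i * f (i + 1) x = f 0 x * G x := by
          simp only [hG, Finset.mul_sum]
          refine Finset.sum_congr rfl fun i _ => ?_
          field_simp
        rw [Finset.sum_range_succ']
        change (∑ i ∈ Finset.range (k + 1), d i * f (i + 1) x) + -G p * f 0 x =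
          f 0 x * (G x - G p)
        rw [h4]
        ring
      have h3 := hloc (k + 1) (by omega) p hp e (by
        rw [analyticOrderAt_congr h2,
          analyticOrderAt_mul (hf 0 p hpI) (hGa.fun_sub analyticAt_const)]
        exact h1.trans le_add_self)
      intro i hi
      exact h3 (i + 1) (by omega)
    have hg0 : N ≠ 0 → ∀ x ∈ interior I, g 0 x ≠ 0 := by
      intro hN x hx h0
      have := hlocg 0 (Nat.pos_of_ne_zero hN) x hx (fun _ => 1) (by
        simp only [zero_add, Finset.sum_range_one, one_mul, Nat.cast_one]
        rw [Order.one_le_iff_ne_zero, analyticOrderAt_ne_zero]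
        exact ⟨hga 0 x (interior_subset hx), h0⟩) 0 le_rfl
      simp at this
    have hN : N ≠ 0 := by rintro rfl; simp at hc'
    obtain ⟨S, hS, hTS⟩ := exists_finset_deriv_eq_zero hI
      (f := fun x => c 0 + ∑ i ∈ Finset.range N, c (i + 1) * (f (i + 1) x / f 0 x))
      (fun x hx => by
        have : AnalyticAt ℝ
            (fun x => c 0 + ∑ i ∈ Finset.range N, c (i + 1) * (f (i + 1) x / f 0 x)) x :=
          analyticAt_const.fun_add
            (Finset.analyticAt_fun_sum _ fun i _ => analyticAt_const.mul (hquot i x hx))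
        exact this.continuousAt.continuousWithinAt)
      T (fun x hx => (hT x hx).1) (fun x hx => by
        obtain ⟨hxI, h⟩ := hT x hx
        rw [Finset.sum_range_succ'] at h
        have hx0 := hf0 x hxI
        refine (mul_eq_zero.1 (?_ : f 0 x * _ = 0)).resolve_left hx0
        rw [← h, mul_add, Finset.mul_sum, add_comm]
        congr 1
        · refine Finset.sum_congr rfl fun i _ => ?_
          field_simp
        · ring)
    have := ih (interior I) hI.interior g (fun i => (hga i).mono interior_subset) (hg0 hN)
      (by rwa [interior_interior]) (fun i => c (i + 1)) hc' S (fun x hx => by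
        refine ⟨(hS x hx).1, ?_⟩
        rw [← hderiv _ (fun i => c (i + 1)) x (interior_subset (hS x hx).1), ← (hS x hx).2,
          deriv_const_add])
    omega

/-- The functions `a X + b X³ + (c X + d X³) arsinh y` of `y`, where `X = √(1 + y²)`. -/
noncomputable def algLog (a b c d y : ℝ) : ℝ :=
  a * √(1 + y ^ 2) + b * √(1 + y ^ 2) ^ 3
    + (c * √(1 + y ^ 2) + d * √(1 + y ^ 2) ^ 3) * arsinh y

theorem sqrt_one_add_sq_pos (y : ℝ) : 0 < √(1 + y ^ 2) := by positivity

theorem sq_sqrt_one_add_sq (y : ℝ) : √(1 + y ^ 2) ^ 2 = 1 + y ^ 2 := sq_sqrt (by positivity)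

theorem hasDerivAt_sqrt_one_add_sq (y : ℝ) :
    HasDerivAt (fun y : ℝ => √(1 + y ^ 2)) (y / √(1 + y ^ 2)) y := by
  have h := ((hasDerivAt_pow 2 y).const_add 1).sqrt (by positivity)
  refine h.congr_deriv ?_
  have h0 := (sqrt_one_add_sq_pos y).ne'
  field_simp
  norm_num

theorem deriv_algLog (a b c d : ℝ) : deriv (algLog a b c d) = fun y =>
    a * (y / √(1 + y ^ 2)) + b * (3 * y * √(1 + y ^ 2)) + c * (y / √(1 + y ^ 2) * arsinh y + 1)
      + d * (3 * y * √(1 + y ^ 2) * arsinh y + √(1 + y ^ 2) ^ 2) := by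
  funext y
  have hX := hasDerivAt_sqrt_one_add_sq y
  have hL := hasDerivAt_arsinh y
  have h := ((hX.const_mul a).add ((hX.pow 3).const_mul b)).add
    (((hX.const_mul c).add ((hX.pow 3).const_mul d)).mul hL)
  refine HasDerivAt.deriv (h.congr_deriv ?_)
  have h0 := (sqrt_one_add_sq_pos y).ne'
  have h2 := sq_sqrt_one_add_sq y
  simp only [Pi.add_apply, Pi.pow_apply] at *
  generalize √(1 + y ^ 2) = X at *
  generalize arsinh y = L at *
  field_simp
  ring

theorem deriv_deriv_algLog (a b c d : ℝ) : deriv (deriv (algLog a b c d)) = fun y =>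
    a / √(1 + y ^ 2) ^ 3 + b * (6 * √(1 + y ^ 2) - 3 / √(1 + y ^ 2))
      + c * (arsinh y / √(1 + y ^ 2) ^ 3 + y / √(1 + y ^ 2) ^ 2)
      + d * ((6 * √(1 + y ^ 2) - 3 / √(1 + y ^ 2)) * arsinh y + 5 * y) := by
  funext y
  rw [deriv_algLog]
  have hX := hasDerivAt_sqrt_one_add_sq y
  have hL := hasDerivAt_arsinh y
  have h0 := (sqrt_one_add_sq_pos y).ne'
  have hy := hasDerivAt_id' y
  have h := ((((hy.div hX h0).const_mul a).add (((hy.const_mul 3).mul hX).const_mul b)).add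
    ((((hy.div hX h0).mul hL).add_const 1).const_mul c)).add
    (((((hy.const_mul 3).mul hX).mul hL).add (hX.pow 2)).const_mul d)
  refine HasDerivAt.deriv (h.congr_deriv ?_)
  have h2 := sq_sqrt_one_add_sq y
  simp only [Pi.mul_apply, Pi.add_apply, Pi.pow_apply, Pi.div_apply] at *
  generalize √(1 + y ^ 2) = X at *
  generalize arsinh y = L at *
  have h3 : y ^ 2 = X ^ 2 - 1 := by linarith
  field_simp
  grind

theorem iteratedDeriv_three_algLog (a b c d : ℝ) : iteratedDeriv 3 (algLog a b c d) = fun y =>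
    a * (-3 * y / √(1 + y ^ 2) ^ 5) + b * (6 * y / √(1 + y ^ 2) + 3 * y / √(1 + y ^ 2) ^ 3)
      + c * (-3 * y / √(1 + y ^ 2) ^ 5 * arsinh y + 3 / √(1 + y ^ 2) ^ 4 - 1 / √(1 + y ^ 2) ^ 2)
      + d * ((6 * y / √(1 + y ^ 2) + 3 * y / √(1 + y ^ 2) ^ 3) * arsinh y
        + 11 - 3 / √(1 + y ^ 2) ^ 2) := by
  funext y
  rw [iteratedDeriv_succ, iteratedDeriv_succ, iteratedDeriv_one, deriv_deriv_algLog]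
  have hX := hasDerivAt_sqrt_one_add_sq y
  have hL := hasDerivAt_arsinh y
  have h0 := (sqrt_one_add_sq_pos y).ne'
  have hy := hasDerivAt_id' y
  have hu := (hX.const_mul 6).sub ((hasDerivAt_const y (3 : ℝ)).div hX h0)
  have h := ((((hasDerivAt_const y a).div (hX.pow 3) (pow_ne_zero 3 h0)).add
    (hu.const_mul b)).add
    (((hL.div (hX.pow 3) (pow_ne_zero 3 h0)).add
      (hy.div (hX.pow 2) (pow_ne_zero 2 h0))).const_mul c)).add
    (((hu.mul hL).add (hy.const_mul 5)).const_mul d)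
  refine HasDerivAt.deriv (h.congr_deriv ?_)
  have h2 := sq_sqrt_one_add_sq y
  simp only [Pi.mul_apply, Pi.add_apply, Pi.pow_apply, Pi.div_apply, Pi.sub_apply] at *
  generalize √(1 + y ^ 2) = X at *
  generalize arsinh y = L at *
  have h3 : y ^ 2 = X ^ 2 - 1 := by linarith
  field_simp
  grind

/-- `X⁵` times the fourth derivative of `algLog a b c d`. -/
noncomputable def quarticDeriv (a b c d y : ℝ) : ℝ :=
  9 * b + a * (12 - 15 / √(1 + y ^ 2) ^ 2)
    + c * ((12 - 15 / √(1 + y ^ 2) ^ 2) * arsinh y - 15 * y / √(1 + y ^ 2)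
      + 2 * y * √(1 + y ^ 2))
    + d * (9 * arsinh y + 6 * y * √(1 + y ^ 2) ^ 3 + 9 * y * √(1 + y ^ 2))

theorem iteratedDeriv_four_algLog (a b c d : ℝ) : iteratedDeriv 4 (algLog a b c d) = fun y =>
    (√(1 + y ^ 2) ^ 5)⁻¹ * quarticDeriv a b c d y := by
  funext y
  rw [iteratedDeriv_succ, iteratedDeriv_three_algLog]
  have hX := hasDerivAt_sqrt_one_add_sq y
  have hL := hasDerivAt_arsinh y
  have h0 := (sqrt_one_add_sq_pos y).ne'
  have hy := hasDerivAt_id' y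
  have hu := (hy.const_mul (-3)).div (hX.pow 5) (pow_ne_zero 5 h0)
  have hv := ((hy.const_mul 6).div hX h0).add
    ((hy.const_mul 3).div (hX.pow 3) (pow_ne_zero 3 h0))
  have h := (((hu.const_mul a).add (hv.const_mul b)).add
    ((((hu.mul hL).add ((hasDerivAt_const y (3 : ℝ)).div (hX.pow 4) (pow_ne_zero 4 h0))).sub
      ((hasDerivAt_const y (1 : ℝ)).div (hX.pow 2) (pow_ne_zero 2 h0))).const_mul c)).add
    ((((hv.mul hL).add_const 11).sub
      ((hasDerivAt_const y (3 : ℝ)).div (hX.pow 2) (pow_ne_zero 2 h0))).const_mul d)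
  refine HasDerivAt.deriv (h.congr_deriv ?_)
  have h2 := sq_sqrt_one_add_sq y
  simp only [quarticDeriv, Pi.mul_apply, Pi.add_apply, Pi.pow_apply, Pi.div_apply,
    Pi.sub_apply] at *
  generalize √(1 + y ^ 2) = X at *
  generalize arsinh y = L at *
  have h3 : y ^ 2 = X ^ 2 - 1 := by linarith
  field_simp
  grind

theorem deriv_quarticDeriv (a b c d : ℝ) : deriv (quarticDeriv a b c d) = fun y =>
    (√(1 + y ^ 2))⁻¹ * (a * (30 * y / √(1 + y ^ 2) ^ 3)
      + c * (30 * arsinh y * y / √(1 + y ^ 2) ^ 3 + 4 * √(1 + y ^ 2) ^ 2 + 10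
        - 30 / √(1 + y ^ 2) ^ 2) + d * (24 * √(1 + y ^ 2) ^ 4)) := by
  funext y
  have hX := hasDerivAt_sqrt_one_add_sq y
  have hL := hasDerivAt_arsinh y
  have h0 := (sqrt_one_add_sq_pos y).ne'
  have hy := hasDerivAt_id' y
  have hu := ((hasDerivAt_const y (15 : ℝ)).div (hX.pow 2) (pow_ne_zero 2 h0)).const_sub 12
  have h := (((hu.const_mul a).const_add (9 * b)).add
    ((((hu.mul hL).sub ((hy.const_mul 15).div hX h0)).add
      ((hy.const_mul 2).mul hX)).const_mul c)).add
    ((((hL.const_mul 9).add ((hy.const_mul 6).mul (hX.pow 3))).add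
      ((hy.const_mul 9).mul hX)).const_mul d)
  refine HasDerivAt.deriv (h.congr_deriv ?_)
  have h2 := sq_sqrt_one_add_sq y
  simp only [Pi.add_apply, Pi.pow_apply, Pi.div_apply, Pi.sub_apply] at *
  generalize √(1 + y ^ 2) = X at *
  generalize arsinh y = L at *
  have h3 : y ^ 2 = X ^ 2 - 1 := by linarith
  field_simp
  grind

/-- `X⁴ / y` times the derivative of `quarticDeriv a b c d`. -/
noncomputable def quinticDeriv (a c d y : ℝ) : ℝ :=
  30 * a + c * (30 * arsinh y
    + (4 * √(1 + y ^ 2) ^ 5 + 10 * √(1 + y ^ 2) ^ 3 - 30 * √(1 + y ^ 2)) / y)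
    + d * (24 * √(1 + y ^ 2) ^ 7 / y)

theorem hasDerivAt_quinticDeriv (a c d : ℝ) {y : ℝ} (hy0 : y ≠ 0) :
    HasDerivAt (quinticDeriv a c d)
      (√(1 + y ^ 2) ^ 5 / y ^ 2 * (16 * c + d * (24 * (6 * y ^ 2 - 1)))) y := by
  have hX := hasDerivAt_sqrt_one_add_sq y
  have hL := hasDerivAt_arsinh y
  have h0 := (sqrt_one_add_sq_pos y).ne'
  have hy := hasDerivAt_id' y
  have h := ((((hL.const_mul 30).add (((((hX.pow 5).const_mul 4).add
    ((hX.pow 3).const_mul 10)).sub (hX.const_mul 30)).div hy hy0)).const_mul c).const_add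
      (30 * a)).add ((((hX.pow 7).const_mul 24).div hy hy0).const_mul d)
  refine h.congr_deriv ?_
  have h2 := sq_sqrt_one_add_sq y
  simp only [Pi.add_apply, Pi.pow_apply, Pi.div_apply, Pi.sub_apply] at *
  generalize √(1 + y ^ 2) = X at *
  have h3 : y ^ 2 = X ^ 2 - 1 := by linarith
  field_simp
  grind

/-- The operator `((1 + y²) D² + y D - μ)` transported through `k` differentiations. -/
noncomputable def gegenbauerOp (k : ℕ) (μ : ℝ) (u : ℝ → ℝ) (y : ℝ) : ℝ :=
  (1 + y ^ 2) * deriv (deriv u) y + (2 * k + 1) * y * deriv u y + (k ^ 2 - μ) * u y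

theorem analyticAt_gegenbauerOp (k : ℕ) (μ : ℝ) {u : ℝ → ℝ} (hu : ∀ y, AnalyticAt ℝ u y) (y : ℝ) :
    AnalyticAt ℝ (gegenbauerOp k μ u) y := by
  have h1 := (hu y).deriv
  have h2 := h1.deriv
  have h := hu y
  unfold gegenbauerOp
  fun_prop

theorem deriv_gegenbauerOp (k : ℕ) (μ : ℝ) {u : ℝ → ℝ} (hu : ∀ y, AnalyticAt ℝ u y) :
    deriv (gegenbauerOp k μ u) = gegenbauerOp (k + 1) μ (deriv u) := by
  funext y
  have h0 := (hu y).differentiableAt.hasDerivAt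
  have h1 := (hu y).deriv.differentiableAt.hasDerivAt
  have h2 := (hu y).deriv.deriv.differentiableAt.hasDerivAt
  have hy := hasDerivAt_id' y
  have h := ((((hasDerivAt_pow 2 y).const_add 1).mul h2).add
    ((hy.const_mul (2 * (k : ℝ) + 1)).mul h1)).add (h0.const_mul ((k : ℝ) ^ 2 - μ))
  refine HasDerivAt.deriv (h.congr_deriv ?_)
  simp only [gegenbauerOp]
  push_cast
  ring

theorem iteratedDeriv_gegenbauerOp (m : ℕ) : ∀ (k : ℕ) (μ : ℝ) {u : ℝ → ℝ}
    (_ : ∀ y, AnalyticAt ℝ u y),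
    iteratedDeriv m (gegenbauerOp k μ u) = gegenbauerOp (k + m) μ (iteratedDeriv m u) := by
  induction m with
  | zero => intro k μ u _; simp
  | succ m ih =>
    intro k μ u hu
    rw [iteratedDeriv_succ', deriv_gegenbauerOp k μ hu, ih _ _ fun y => (hu y).deriv,
      iteratedDeriv_succ', add_right_comm, add_assoc]

theorem eq_zero_of_iteratedDeriv_eq_zero {u : ℝ → ℝ} (hu : ∀ y, AnalyticAt ℝ u y) {p : ℝ}
    (h : ∀ j, iteratedDeriv j u p = 0) : u = 0 := by
  rw [← AnalyticOnNhd.analyticOrderAt_eq_top_iff_eq_zero p fun y => hu y]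
  refine ENat.eq_top_iff_forall_ge.2 fun m => ?_
  rw [natCast_le_analyticOrderAt_iff_iteratedDeriv_eq_zero (hu p)]
  exact fun i _ => h i

theorem eq_zero_of_gegenbauerOp_eq_zero {k : ℕ} {μ : ℝ} {u : ℝ → ℝ}
    (hu : ∀ y, AnalyticAt ℝ u y) (h : gegenbauerOp k μ u = 0) {p : ℝ} (h0 : u p = 0)
    (h1 : deriv u p = 0) : u = 0 := by
  refine eq_zero_of_iteratedDeriv_eq_zero hu (p := p) fun j => ?_
  induction j generalizing k u with
  | zero => simpa
  | succ j ih =>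
    rw [iteratedDeriv_succ']
    refine ih (k := k + 1) (fun y => (hu y).deriv) ?_ h1 ?_
    · rw [← deriv_gegenbauerOp k μ hu, h]
      exact deriv_const' 0
    · have hp := congrFun h p
      simp only [gegenbauerOp, h0, h1, mul_zero, add_zero, Pi.zero_apply] at hp
      exact (mul_eq_zero.1 hp).resolve_left (by positivity)

theorem eq_zero_of_gegenbauerOp_gegenbauerOp_eq_zero {k : ℕ} {μ ν : ℝ} {u : ℝ → ℝ}
    (hu : ∀ y, AnalyticAt ℝ u y) (h : gegenbauerOp k μ (gegenbauerOp k ν u) = 0) {p : ℝ}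
    (hp : ∀ j < 4, iteratedDeriv j u p = 0) : u = 0 := by
  have h0 := hp 0 (by norm_num)
  have h1 := hp 1 (by norm_num)
  have h2 := hp 2 (by norm_num)
  have h3 := hp 3 (by norm_num)
  simp only [iteratedDeriv_succ, iteratedDeriv_zero] at h0 h1 h2 h3
  refine eq_zero_of_gegenbauerOp_eq_zero hu (k := k) (μ := ν) (p := p) ?_ h0 h1
  refine eq_zero_of_gegenbauerOp_eq_zero (analyticAt_gegenbauerOp k ν hu) h (p := p) ?_ ?_
  · simp [gegenbauerOp, h0, h1, h2]
  · rw [deriv_gegenbauerOp k ν hu]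
    simp [gegenbauerOp, h1, h2, h3]

theorem analyticAt_sqrt_one_add_sq (y : ℝ) : AnalyticAt ℝ (fun y : ℝ => √(1 + y ^ 2)) y :=
  AnalyticAt.fun_comp (f := fun y : ℝ => 1 + y ^ 2)
    ((contDiffAt_sqrt (by positivity)).analyticAt) (by fun_prop)

theorem analyticAt_algLog (a b c d y : ℝ) : AnalyticAt ℝ (algLog a b c d) y := by
  have hX := analyticAt_sqrt_one_add_sq y
  have hL : AnalyticAt ℝ arsinh y := analyticAt_arsinh
  unfold algLog
  fun_prop

theorem gegenbauerOp_algLog (a b c d : ℝ) : gegenbauerOp 0 9 (algLog a b c d) = fun y =>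
    algLog (-8 * a - 6 * b) 0 (-8 * c - 6 * d) 0 y
      + ((2 * c + 6 * d) * y + 6 * d * y ^ 3) := by
  funext y
  rw [gegenbauerOp, deriv_deriv_algLog, deriv_algLog]
  simp only [algLog, Nat.cast_zero]
  have h0 := (sqrt_one_add_sq_pos y).ne'
  have h2 := sq_sqrt_one_add_sq y
  generalize √(1 + y ^ 2) = X at *
  generalize arsinh y = L at *
  have h3 : y ^ 2 = X ^ 2 - 1 := by linarith
  norm_num
  field_simp
  grind

theorem gegenbauerOp_gegenbauerOp_algLog (a b c d : ℝ) :
    gegenbauerOp 0 1 (gegenbauerOp 0 9 (algLog a b c d)) = fun y =>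
      (24 * d - 16 * c) * y + 48 * d * y ^ 3 := by
  set q : ℝ → ℝ := fun y => (2 * c + 6 * d) * y + 6 * d * y ^ 3 with hq
  have hq1 : deriv q = fun y => (2 * c + 6 * d) + 18 * d * y ^ 2 := by
    funext y
    refine HasDerivAt.deriv ((((hasDerivAt_id' y).const_mul _).add
      ((hasDerivAt_pow 3 y).const_mul _)).congr_deriv ?_)
    norm_num
    ring
  have hq2 : deriv (deriv q) = fun y => 36 * d * y := by
    funext y
    rw [hq1]
    refine HasDerivAt.deriv ((((hasDerivAt_pow 2 y).const_mul (18 * d)).const_add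
      (2 * c + 6 * d)).congr_deriv ?_)
    norm_num
    ring
  have hqa (y : ℝ) : AnalyticAt ℝ q y := by fun_prop
  rw [gegenbauerOp_algLog]
  set g := algLog (-8 * a - 6 * b) 0 (-8 * c - 6 * d) 0 with hg
  have hga := analyticAt_algLog (-8 * a - 6 * b) 0 (-8 * c - 6 * d) 0
  have h1 : deriv (fun y => g y + q y) = fun y => deriv g y + deriv q y :=
    funext fun y => deriv_fun_add (hga y).differentiableAt (hqa y).differentiableAt
  have h2 : deriv (deriv fun y => g y + q y) = fun y => deriv (deriv g) y + deriv (deriv q) y := by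
    rw [h1]
    exact funext fun y => deriv_fun_add (hga y).deriv.differentiableAt (hqa y).deriv.differentiableAt
  funext y
  change gegenbauerOp 0 1 (fun y => g y + q y) y = _
  rw [gegenbauerOp, h2, h1, hq2, hq1, hg, deriv_deriv_algLog, deriv_algLog]
  simp only [algLog, hq, Nat.cast_zero]
  have h0 := (sqrt_one_add_sq_pos y).ne'
  have h2 := sq_sqrt_one_add_sq y
  generalize √(1 + y ^ 2) = X at *
  generalize arsinh y = L at *
  have h3 : y ^ 2 = X ^ 2 - 1 := by linarith
  norm_num
  field_simp
  grind

theorem iteratedDeriv_polynomial_eval (m : ℕ) (q : Polynomial ℝ) :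
    iteratedDeriv m (fun y => q.eval y) = fun y => (Polynomial.derivative^[m] q).eval y := by
  induction m generalizing q with
  | zero => simp
  | succ m ih =>
    rw [iteratedDeriv_succ', Function.iterate_succ_apply, ← ih]
    congr 1
    exact funext fun y => q.deriv

theorem gegenbauerOp_gegenbauerOp_iteratedDeriv_algLog (a b c d : ℝ) {k : ℕ} (hk : 4 ≤ k) :
    gegenbauerOp k 1 (gegenbauerOp k 9 (iteratedDeriv k (algLog a b c d))) = 0 := by
  have hG := analyticAt_algLog a b c d
  have h := iteratedDeriv_gegenbauerOp k 0 1 (analyticAt_gegenbauerOp 0 9 hG)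
  rw [iteratedDeriv_gegenbauerOp k 0 9 hG, zero_add] at h
  rw [← h, gegenbauerOp_gegenbauerOp_algLog]
  have hp : (fun y : ℝ => (24 * d - 16 * c) * y + 48 * d * y ^ 3) = fun y =>
      (Polynomial.C (24 * d - 16 * c) * Polynomial.X
        + Polynomial.C (48 * d) * Polynomial.X ^ 3).eval y := by
    funext y; simp
  rw [hp, iteratedDeriv_polynomial_eval, Polynomial.iterate_derivative_eq_zero]
  · funext y; simp
  · refine lt_of_le_of_lt (b := 3) ?_ hk
    compute_degree

theorem iteratedDeriv_four_algLog_eq_zero (a b c d : ℝ) {k : ℕ} (hk : 4 ≤ k)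
    (h : iteratedDeriv k (algLog a b c d) = 0) : iteratedDeriv 4 (algLog a b c d) = 0 := by
  induction k, hk using Nat.le_induction with
  | base => exact h
  | succ k hk ih =>
    refine ih ?_
    have hG : ∀ y, AnalyticAt ℝ (iteratedDeriv k (algLog a b c d)) y := fun y => by
      rw [iteratedDeriv_eq_iterate]
      exact (analyticAt_algLog a b c d y).iterated_deriv k
    rw [iteratedDeriv_succ] at h
    obtain ⟨C, hC⟩ : ∃ C, iteratedDeriv k (algLog a b c d) = fun _ => C :=
      ⟨_, funext fun y => is_const_of_deriv_eq_zero
        (fun y => (hG y).differentiableAt) (fun y => congrFun h y) y 0⟩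
    have h1 := congrFun (gegenbauerOp_gegenbauerOp_iteratedDeriv_algLog a b c d hk) 0
    have h2 : gegenbauerOp k 9 (fun _ => C) = fun _ => ((k : ℝ) ^ 2 - 9) * C := by
      funext y; simp [gegenbauerOp]
    rw [hC, h2] at h1
    simp only [gegenbauerOp, deriv_const', Pi.zero_apply, mul_zero, zero_add, add_zero] at h1
    have hk' : (4 : ℝ) ≤ k := by exact_mod_cast hk
    have h3 : (k : ℝ) ^ 2 - 1 ≠ 0 := by nlinarith
    have h4 : (k : ℝ) ^ 2 - 9 ≠ 0 := by nlinarith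
    simp only [mul_eq_zero, h3, h4, false_or] at h1
    rw [hC, h1]
    rfl

theorem analyticAt_quarticDeriv (a b c d y : ℝ) : AnalyticAt ℝ (quarticDeriv a b c d) y := by
  have hX := analyticAt_sqrt_one_add_sq y
  have hL : AnalyticAt ℝ arsinh y := analyticAt_arsinh
  have h0 := (sqrt_one_add_sq_pos y).ne'
  have h2 : AnalyticAt ℝ (fun y : ℝ => 15 / √(1 + y ^ 2) ^ 2) y :=
    analyticAt_const.fun_div (hX.fun_pow 2) (pow_ne_zero 2 h0)
  have h1 : AnalyticAt ℝ (fun y : ℝ => 15 * y / √(1 + y ^ 2)) y :=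
    (analyticAt_const.fun_mul analyticAt_id).fun_div hX h0
  unfold quarticDeriv
  fun_prop

theorem analyticAt_quinticDeriv (a c d : ℝ) {y : ℝ} (hy : y ≠ 0) :
    AnalyticAt ℝ (quinticDeriv a c d) y := by
  have hX := analyticAt_sqrt_one_add_sq y
  have hL : AnalyticAt ℝ arsinh y := analyticAt_arsinh
  have h1 : AnalyticAt ℝ (fun y : ℝ =>
      (4 * √(1 + y ^ 2) ^ 5 + 10 * √(1 + y ^ 2) ^ 3 - 30 * √(1 + y ^ 2)) / y) y :=
    AnalyticAt.fun_div (by fun_prop) analyticAt_id hy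
  have h2 : AnalyticAt ℝ (fun y : ℝ => 24 * √(1 + y ^ 2) ^ 7 / y) y :=
    AnalyticAt.fun_div (by fun_prop) analyticAt_id hy
  unfold quinticDeriv
  fun_prop

theorem analyticAt_iteratedDeriv_algLog (a b c d : ℝ) (k : ℕ) (y : ℝ) :
    AnalyticAt ℝ (iteratedDeriv k (algLog a b c d)) y := by
  rw [iteratedDeriv_eq_iterate]
  exact (analyticAt_algLog a b c d y).iterated_deriv k

theorem apply_eq_zero_of_one_le_analyticOrderAt {f : ℝ → ℝ} {p : ℝ} {k : ℕ} (hk : 1 ≤ k)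
    (h : (k : ℕ∞) ≤ analyticOrderAt f p) : f p = 0 := by
  refine apply_eq_zero_of_analyticOrderAt_ne_zero fun h0 => ?_
  rw [h0] at h
  have : k = 0 := by simpa using h
  omega

theorem le_analyticOrderAt_quinticDeriv {a b c d p : ℝ} (hp : p ≠ 0) {k : ℕ}
    (h : ((k + 1 : ℕ) : ℕ∞) ≤ analyticOrderAt (quarticDeriv a b c d) p) :
    (k : ℕ∞) ≤ analyticOrderAt (quinticDeriv a c d) p := by
  have hX := analyticAt_sqrt_one_add_sq p
  refine le_analyticOrderAt_mul_deriv (analyticAt_quarticDeriv a b c d p)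
    (g := fun y => √(1 + y ^ 2) ^ 4 / y) ((hX.fun_pow 4).fun_div analyticAt_id hp) ?_ h
  filter_upwards [isOpen_ne.mem_nhds hp] with y hy
  have h0 := (sqrt_one_add_sq_pos y).ne'
  rw [deriv_quarticDeriv, quinticDeriv]
  dsimp only
  clear hX
  generalize √(1 + y ^ 2) = X at *
  generalize arsinh y = L at *
  have hy : y ≠ 0 := hy
  field_simp
  ring

theorem le_analyticOrderAt_of_quinticDeriv {a c d p : ℝ} (hp : p ≠ 0) {k : ℕ}
    (h : ((k + 1 : ℕ) : ℕ∞) ≤ analyticOrderAt (quinticDeriv a c d) p) :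
    (k : ℕ∞) ≤ analyticOrderAt (fun y : ℝ => 16 * c + d * (24 * (6 * y ^ 2 - 1))) p := by
  have hX := analyticAt_sqrt_one_add_sq p
  refine le_analyticOrderAt_mul_deriv (analyticAt_quinticDeriv a c d hp)
    (g := fun y => y ^ 2 / √(1 + y ^ 2) ^ 5)
    ((analyticAt_id.fun_pow 2).fun_div (hX.fun_pow 5)
      (pow_ne_zero 5 (sqrt_one_add_sq_pos p).ne')) ?_ h
  filter_upwards [isOpen_ne.mem_nhds hp] with y hy
  have h0 := (sqrt_one_add_sq_pos y).ne'
  have hy : y ≠ 0 := hy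
  rw [(hasDerivAt_quinticDeriv a c d hy).deriv]
  field_simp

theorem algLog_coeff_eq_zero {a b c d p : ℝ} (hp : 0 < p) {r : ℕ} (hr : 1 ≤ r)
    (ha : r < 2 → a = 0) (hc : r < 3 → c = 0) (hd : r < 4 → d = 0)
    (h : (r : ℕ∞) ≤ analyticOrderAt (iteratedDeriv 4 (algLog a b c d)) p) :
    a = 0 ∧ b = 0 ∧ c = 0 ∧ d = 0 := by
  have hX := analyticAt_sqrt_one_add_sq p
  have hA : (r : ℕ∞) ≤ analyticOrderAt (quarticDeriv a b c d) p := by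
    have : quarticDeriv a b c d =
        (fun y : ℝ => √(1 + y ^ 2) ^ 5) * iteratedDeriv 4 (algLog a b c d) := by
      funext y
      have h0 := (sqrt_one_add_sq_pos y).ne'
      rw [iteratedDeriv_four_algLog, Pi.mul_apply, mul_inv_cancel_left₀ (pow_ne_zero 5 h0)]
    rw [this, analyticOrderAt_mul (hX.fun_pow 5) (analyticAt_iteratedDeriv_algLog a b c d 4 p)]
    exact h.trans le_add_self
  have hB (k : ℕ) (hk : k + 1 ≤ r) : (k : ℕ∞) ≤ analyticOrderAt (quinticDeriv a c d) p :=
    le_analyticOrderAt_quinticDeriv hp.ne' (le_trans (by exact_mod_cast hk) hA)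
  have hC (k : ℕ) (hk : k + 2 ≤ r) := le_analyticOrderAt_of_quinticDeriv hp.ne' (hB (k + 1) hk)
  have hd0 : d = 0 := by
    by_cases h4 : r < 4
    · exact hd h4
    have hD := apply_eq_zero_of_one_le_analyticOrderAt le_rfl
      (le_analyticOrderAt_deriv (by fun_prop) (hC 2 (by omega)))
    have hD' : HasDerivAt (fun y : ℝ => 16 * c + d * (24 * (6 * y ^ 2 - 1)))
        (d * (24 * (6 * (2 * p)))) p := by
      simpa using (((((hasDerivAt_pow 2 p).const_mul 6).sub_const 1).const_mul 24).const_mul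
        d).const_add (16 * c)
    rw [hD'.deriv] at hD
    exact (mul_eq_zero.1 hD).resolve_right (by positivity)
  subst hd0
  have hc0 : c = 0 := by
    by_cases h3 : r < 3
    · exact hc h3
    have := apply_eq_zero_of_one_le_analyticOrderAt le_rfl (hC 1 (by omega))
    simpa using this
  subst hc0
  have ha0 : a = 0 := by
    by_cases h2 : r < 2
    · exact ha h2
    have := apply_eq_zero_of_one_le_analyticOrderAt le_rfl (hB 1 (by omega))
    simpa [quinticDeriv] using this
  subst ha0
  have := apply_eq_zero_of_one_le_analyticOrderAt hr hA
  simpa [quarticDeriv] using this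

theorem analyticAt_polynomial_eval (Q : Polynomial ℝ) (y : ℝ) :
    AnalyticAt ℝ (fun y => Q.eval y) y :=
  AnalyticOnNhd.eval_polynomial Q y (Set.mem_univ y)

theorem iteratedDeriv_add_algLog (Q : Polynomial ℝ) (a b c d : ℝ) (j : ℕ) (y : ℝ) :
    iteratedDeriv j (fun y => Q.eval y + algLog a b c d y) y =
      (Polynomial.derivative^[j] Q).eval y + iteratedDeriv j (algLog a b c d) y := by
  rw [iteratedDeriv_fun_add (analyticAt_polynomial_eval Q y).contDiffAt (analyticAt_algLog a b c d y).contDiffAt,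
    iteratedDeriv_polynomial_eval]

theorem eq_zero_of_le_analyticOrderAt {Q : Polynomial ℝ} {a b c d p : ℝ} (hp : 0 < p) {k m : ℕ}
    (hmk : m ≤ k + 1) (hQ : Q.natDegree < m) (hm : 4 ≤ k → m = max 4 (k - 3))
    (ha : k < 5 → a = 0) (hb : k < 4 → b = 0) (hc : k < 6 → c = 0) (hd : k < 7 → d = 0)
    (h : ((k + 1 : ℕ) : ℕ∞) ≤ analyticOrderAt (fun y => Q.eval y + algLog a b c d y) p) :
    Q = 0 ∧ a = 0 ∧ b = 0 ∧ c = 0 ∧ d = 0 := by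
  rw [natCast_le_analyticOrderAt_iff_iteratedDeriv_eq_zero
    ((analyticAt_polynomial_eval Q p).fun_add (analyticAt_algLog a b c d p))] at h
  simp only [iteratedDeriv_add_algLog] at h
  have hQ0 (j : ℕ) (hj : m ≤ j) : Polynomial.derivative^[j] Q = 0 :=
    Polynomial.iterate_derivative_eq_zero (hQ.trans_le hj)
  have hG (j : ℕ) (hj : m ≤ j) (hjk : j ≤ k) : iteratedDeriv j (algLog a b c d) p = 0 := by
    simpa [hQ0 j hj] using h j (by omega)
  have hcoeff : a = 0 ∧ b = 0 ∧ c = 0 ∧ d = 0 := by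
    rcases lt_or_ge k 4 with hk | hk
    · exact ⟨ha (by omega), hb (by omega), hc (by omega), hd (by omega)⟩
    have hm := hm hk
    refine algLog_coeff_eq_zero hp (r := min 4 (k - 3)) (by omega) (fun _ => ha (by omega))
      (fun _ => hc (by omega)) (fun _ => hd (by omega)) ?_
    rw [natCast_le_analyticOrderAt_iff_iteratedDeriv_eq_zero
      (analyticAt_iteratedDeriv_algLog a b c d 4 p)]
    have hadd (i j : ℕ) : iteratedDeriv i (iteratedDeriv j (algLog a b c d)) =
        iteratedDeriv (i + j) (algLog a b c d) := by
      simp only [iteratedDeriv_eq_iterate, Function.iterate_add_apply]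
    rcases lt_or_ge k 8 with hk8 | hk8
    · intro i hi
      rw [hadd]
      exact hG _ (by omega) (by omega)
    · have hw := eq_zero_of_gegenbauerOp_gegenbauerOp_eq_zero
        (analyticAt_iteratedDeriv_algLog a b c d m)
        (gegenbauerOp_gegenbauerOp_iteratedDeriv_algLog a b c d (by omega)) (p := p)
        fun j hj => by rw [hadd]; exact hG _ (by omega) (by omega)
      rw [iteratedDeriv_four_algLog_eq_zero a b c d (by omega) hw]
      simp
  refine ⟨?_, hcoeff⟩
  obtain ⟨rfl, rfl, rfl, rfl⟩ := hcoeff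
  have h0 : algLog 0 0 0 0 = 0 := by funext y; simp [algLog]
  have := eq_zero_of_iteratedDeriv_eq_zero (analyticAt_polynomial_eval Q) (p := p) fun j => by
    rw [iteratedDeriv_polynomial_eval]
    rcases lt_or_ge j m with hj | hj
    · simpa [h0] using h j (by omega)
    · simp [hQ0 j hj]
  exact Polynomial.funext fun y => by simpa using congrFun this y

/-- The sequence `1, y, y², y³, X³, X, X L, X³ L, y⁴, y⁵, …` of functions of `y`, where
`X = √(1 + y²)` and `L = arsinh y`. -/
noncomputable def algLogBasis (i : ℕ) (y : ℝ) : ℝ :=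
  match i with
  | 4 => √(1 + y ^ 2) ^ 3
  | 5 => √(1 + y ^ 2)
  | 6 => √(1 + y ^ 2) * arsinh y
  | 7 => √(1 + y ^ 2) ^ 3 * arsinh y
  | i + 8 => y ^ (i + 4)
  | i => y ^ i

theorem analyticAt_algLogBasis (i : ℕ) (y : ℝ) : AnalyticAt ℝ (algLogBasis i) y := by
  have hX := analyticAt_sqrt_one_add_sq y
  have hL : AnalyticAt ℝ arsinh y := analyticAt_arsinh
  unfold algLogBasis
  split <;> fun_prop

theorem sum_algLogBasis (q : ℕ → ℝ) (a b c d y : ℝ) (K : ℕ) (e : ℕ → ℝ) (h4 : e 4 = b)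
    (h5 : e 5 = a) (h6 : e 6 = c) (h7 : e 7 = d) (hlow : ∀ i < 4, e i = q i)
    (hhigh : ∀ i < K, e (i + 8) = q (i + 4)) :
    ∑ i ∈ Finset.range (K + 8), e i * algLogBasis i y =
      ∑ i ∈ Finset.range (K + 4), q i * y ^ i + algLog a b c d y := by
  rw [add_comm K, add_comm K, Finset.sum_range_add, Finset.sum_range_add]
  have : ∑ i ∈ Finset.range K, e (8 + i) * algLogBasis (8 + i) y =
      ∑ i ∈ Finset.range K, q (4 + i) * y ^ (4 + i) := by
    refine Finset.sum_congr rfl fun i hi => ?_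
    rw [add_comm 8, add_comm 4, hhigh i (Finset.mem_range.1 hi)]
    rfl
  rw [this]
  simp only [Finset.sum_range_succ, Finset.sum_range_zero, h4, h5, h6, h7, algLogBasis, algLog,
    hlow 0 (by norm_num), hlow 1 (by norm_num), hlow 2 (by norm_num), hlow 3 (by norm_num)]
  ring

theorem algLogBasis_coeff_eq_zero {k : ℕ} {p : ℝ} (hp : 0 < p) {c : ℕ → ℝ}
    (h : ((k + 1 : ℕ) : ℕ∞) ≤
      analyticOrderAt (fun y => ∑ i ∈ Finset.range (k + 1), c i * algLogBasis i y) p) :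
    ∀ i ≤ k, c i = 0 := by
  set e : ℕ → ℝ := fun i => if i ≤ k then c i else 0 with he
  set q : ℕ → ℝ := fun i => if i < 4 then e i else e (i + 4) with hq
  set Q : Polynomial ℝ :=
    ∑ i ∈ Finset.range (k + 4), Polynomial.C (q i) * Polynomial.X ^ i with hQ
  have hQc (i : ℕ) (hi : i < k + 4) : Q.coeff i = q i := by
    simp [hQ, Polynomial.coeff_X_pow, hi]
  have hsum (y : ℝ) : ∑ i ∈ Finset.range (k + 1), c i * algLogBasis i y =
      Q.eval y + algLog (e 5) (e 4) (e 6) (e 7) y := by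
    have h1 : Q.eval y = ∑ i ∈ Finset.range (k + 4), q i * y ^ i := by
      simp [hQ, Polynomial.eval_finsetSum]
    rw [h1, ← sum_algLogBasis q _ _ _ _ y k e rfl rfl rfl rfl (fun i hi => by simp [hq, hi])
      (fun i _ => by simp [hq])]
    rw [← Finset.sum_subset (Finset.range_mono (by omega : k + 1 ≤ k + 8))]
    · refine Finset.sum_congr rfl fun i hi => ?_
      rw [he]
      simp only [if_pos (Nat.lt_succ_iff.1 (Finset.mem_range.1 hi))]
    · intro i _ hi
      simp only [Finset.mem_range, not_lt] at hi
      simp [he, show ¬ i ≤ k by omega]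
  have hez (i : ℕ) (hi : k < i) : e i = 0 := if_neg (by omega)
  simp only [hsum] at h
  obtain ⟨hQ0, h5, h4, h6, h7⟩ := eq_zero_of_le_analyticOrderAt hp
    (m := if k < 4 then k + 1 else max 4 (k - 3)) (by split_ifs <;> omega) (by
      have hm : (if k < 4 then k else max 3 (k - 4)) + 1 =
        if k < 4 then k + 1 else max 4 (k - 3) := by split_ifs <;> omega
      rw [← hm, Nat.lt_succ_iff, Polynomial.natDegree_le_iff_coeff_eq_zero]
      intro i hi
      rcases lt_or_ge i (k + 4) with hi' | hi'
      · rw [hQc i hi', hq]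
        dsimp only
        split_ifs at hi ⊢ <;> exact hez _ (by omega)
      · simp [hQ, Polynomial.coeff_X_pow, hi'])
    (fun hk => if_neg (by omega)) (fun _ => hez _ (by omega)) (fun _ => hez _ (by omega))
    (fun _ => hez _ (by omega)) (fun _ => hez _ (by omega)) h
  have hq0 (i : ℕ) (hi : i < k + 4) : q i = 0 := by rw [← hQc i hi, hQ0, Polynomial.coeff_zero]
  intro i hi
  have hei : e i = 0 := by
    rcases lt_or_ge i 4 with h | h
    · simpa [hq, h] using hq0 i (by omega)
    rcases lt_or_ge i 8 with h8 | h8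
    · interval_cases i <;> assumption
    · have := hq0 (i - 4) (by omega)
      simpa [hq, show ¬ i - 4 < 4 by omega, Nat.sub_add_cancel h] using this
  simpa [he, hi] using hei

theorem card_zeros_algLog_lt {Q : Polynomial ℝ} {a b c d : ℝ} {K : ℕ} (hQ : Q.natDegree < K + 4)
    (hne : ¬ (Q = 0 ∧ a = 0 ∧ b = 0 ∧ c = 0 ∧ d = 0)) (T : Finset ℝ)
    (hT : ∀ y ∈ T, 0 ≤ y ∧ Q.eval y + algLog a b c d y = 0) : T.card < K + 8 := by
  let e : ℕ → ℝ := fun i => match i with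
    | 4 => b
    | 5 => a
    | 6 => c
    | 7 => d
    | i + 8 => Q.coeff (i + 4)
    | i => Q.coeff i
  have hlow (i : ℕ) (hi : i < 4) : e i = Q.coeff i := by interval_cases i <;> rfl
  have hsum (y : ℝ) : ∑ i ∈ Finset.range (K + 8), e i * algLogBasis i y =
      Q.eval y + algLog a b c d y := by
    rw [sum_algLogBasis Q.coeff a b c d y K e rfl rfl rfl rfl hlow fun _ _ => rfl,
      Polynomial.eval_eq_sum_range' hQ]
  refine card_zeros_lt_of_order_lt (K + 8) (Set.Ici 0) Set.ordConnected_Ici algLogBasis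
    (fun i y _ => analyticAt_algLogBasis i y) (fun y _ => by simp [algLogBasis])
    (fun k _ p hp c hc => algLogBasis_coeff_eq_zero (by simpa using hp) hc) e ?_ T
    (fun y hy => ⟨(hT y hy).1, by rw [hsum, (hT y hy).2]⟩)
  by_contra! he
  refine hne ⟨?_, he 5 (by omega), he 4 (by omega), he 6 (by omega), he 7 (by omega)⟩
  ext i
  rw [Polynomial.coeff_zero]
  rcases lt_or_ge i 4 with hi | hi
  · rw [← hlow i hi, he i (by omega)]
  rcases lt_or_ge i (K + 4) with hi' | hi'
  · have := he (i - 4 + 8) (by omega)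
    change Q.coeff (i - 4 + 4) = 0 at this
    rwa [Nat.sub_add_cancel hi] at this
  · exact Polynomial.coeff_eq_zero_of_natDegree_lt (by omega)

theorem coeff_eq_zero_of_sum_pow_eq_zero {n : ℕ} {c : ℕ → ℝ}
    (h : ∀ w > 1, ∑ i ∈ Finset.range n, c i * w ^ i = 0) : ∀ i < n, c i = 0 := by
  set P : Polynomial ℝ := ∑ i ∈ Finset.range n, Polynomial.C (c i) * Polynomial.X ^ i with hP
  have hP0 : P = 0 := P.eq_zero_of_infinite_isRoot <|
    (Set.Ioi_infinite (1 : ℝ)).mono fun w hw => by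
      simpa [hP, Polynomial.IsRoot, Polynomial.eval_finsetSum] using h w hw
  intro i hi
  have := congrArg (Polynomial.coeff · i) hP0
  simpa [hP, Polynomial.coeff_X_pow, hi] using this

/-- The polynomial part, in the variable `y = √(h(4+h))/2`, of
`h (α₋₂ + α₋₁ h + α₀ h²) + h (4 + h) ∑ αᵢ (2 + h)²ⁱ + √(h (4 + h)) ∑ βᵢ (2 + h)²ⁱ`. -/
noncomputable def polyPart (n : ℕ) (am2 am1 : ℝ) (α β : ℕ → ℝ) : Polynomial ℝ :=
  Polynomial.C (-2 * am2 + 4 * am1 - 8 * α 0)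
    + Polynomial.C (4 * am1 - 24 * α 0) * (1 + Polynomial.X ^ 2)
    + 4 * Polynomial.X ^ 2 *
      ∑ i ∈ Finset.Icc 1 (n - 2), Polynomial.C (α i * 4 ^ i) * (1 + Polynomial.X ^ 2) ^ i
    + 2 * Polynomial.X *
      ∑ i ∈ Finset.range n, Polynomial.C (β i * 4 ^ i) * (1 + Polynomial.X ^ 2) ^ i

theorem eval_polyPart (n : ℕ) (am2 am1 : ℝ) (α β : ℕ → ℝ) (y : ℝ) :
    (polyPart n am2 am1 α β).eval y =
      -2 * am2 + 4 * am1 - 8 * α 0 + (4 * am1 - 24 * α 0) * (1 + y ^ 2)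
        + 4 * y ^ 2 * ∑ i ∈ Finset.Icc 1 (n - 2), α i * 4 ^ i * (1 + y ^ 2) ^ i
        + 2 * y * ∑ i ∈ Finset.range n, β i * 4 ^ i * (1 + y ^ 2) ^ i := by
  simp [polyPart, Polynomial.eval_finsetSum]

theorem natDegree_polyPart_lt {n : ℕ} (hn : 2 ≤ n) (am2 am1 : ℝ) (α β : ℕ → ℝ) :
    (polyPart n am2 am1 α β).natDegree < 2 * n := by
  have hw : (1 + Polynomial.X ^ 2 : Polynomial ℝ).natDegree ≤ 2 := by compute_degree
  have hsum (s : Finset ℕ) (m : ℕ) (hs : ∀ i ∈ s, i ≤ m) (c : ℕ → ℝ) :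
      (∑ i ∈ s, Polynomial.C (c i) * (1 + Polynomial.X ^ 2) ^ i).natDegree ≤ 2 * m := by
    refine Polynomial.natDegree_sum_le_of_forall_le _ _ fun i hi => ?_
    have := hs i hi
    refine (Polynomial.natDegree_C_mul_le _ _).trans ?_
    refine (Polynomial.natDegree_pow_le_of_le i hw).trans ?_
    omega
  refine Nat.lt_of_le_pred (by omega) ?_
  refine Polynomial.natDegree_add_le_of_degree_le (Polynomial.natDegree_add_le_of_degree_le
    (Polynomial.natDegree_add_le_of_degree_le
      ((Polynomial.natDegree_C _).trans_le (Nat.zero_le _)) ?_) ?_) ?_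
  · exact (Polynomial.natDegree_C_mul_le _ _).trans (hw.trans (by rw [Nat.pred_eq_sub_one]; omega))
  · refine (Polynomial.natDegree_mul_le_of_le (m := 2) (by compute_degree)
      (hsum _ (n - 2) (fun i hi => (Finset.mem_Icc.1 hi).2) _)).trans ?_
    rw [Nat.pred_eq_sub_one]; omega
  · refine (Polynomial.natDegree_mul_le_of_le (m := 1) (by compute_degree)
      (hsum _ (n - 1) (fun i hi => ?_) _)).trans ?_
    · have := Finset.mem_range.1 hi; omega
    · rw [Nat.pred_eq_sub_one]; omega

theorem coeff_eq_zero_of_polyPart_eq_zero {n : ℕ} (hn : 2 ≤ n) {am2 am1 : ℝ} {α β : ℕ → ℝ}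
    (h : polyPart n am2 am1 α β = 0) (hα0 : α 0 = 0)
    (ham : 2 * am2 - 8 * am1 + 24 * α 0 = 0) :
    am2 = 0 ∧ am1 = 0 ∧ (∀ k ≤ n - 2, α k = 0) ∧ ∀ k ≤ n - 1, β k = 0 := by
  have heval (y : ℝ) := (eval_polyPart n am2 am1 α β y).symm.trans (by rw [h, Polynomial.eval_zero])
  have ham2 : am2 = 4 * am1 := by rw [hα0] at ham; linarith
  have hev (w : ℝ) (hw : 1 < w) :
      am1 + ∑ i ∈ Finset.Icc 1 (n - 2), α i * 4 ^ i * w ^ i = 0 ∧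
        ∑ i ∈ Finset.range n, β i * 4 ^ i * w ^ i = 0 := by
    have hy : 0 < √(w - 1) := sqrt_pos.2 (by linarith)
    have hy2 : 1 + √(w - 1) ^ 2 = w := by rw [sq_sqrt (by linarith)]; ring
    have h1 := heval √(w - 1)
    have h2 := heval (-√(w - 1))
    rw [neg_sq, hy2, hα0, ham2] at h2
    rw [hy2, hα0, ham2] at h1
    generalize √(w - 1) = y at *
    constructor
    · refine (mul_eq_zero.1 (?_ : 4 * y ^ 2 * _ = 0)).resolve_left (by positivity)
      subst hy2
      linear_combination (h1 + h2) / 2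
    · refine (mul_eq_zero.1 (?_ : 2 * y * _ = 0)).resolve_left (by positivity)
      linear_combination (h1 - h2) / 2
  have hβ := coeff_eq_zero_of_sum_pow_eq_zero fun w hw => (hev w hw).2
  have hα := coeff_eq_zero_of_sum_pow_eq_zero (n := n - 2 + 1)
    (c := fun i => if i = 0 then am1 else α i * 4 ^ i) fun w hw => by
      rw [Finset.sum_range_succ', ← (hev w hw).1, add_comm, Finset.range_eq_Ico,
        Finset.sum_Ico_add' (fun i => (if i = 0 then am1 else α i * 4 ^ i) * w ^ i) 0 (n - 2) 1]
      congr 1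
      · simp
      · refine Finset.sum_congr (by ext; simp) fun i hi => ?_
        rw [if_neg]
        have := (Finset.mem_Icc.1 hi).1
        omega
  have ham1 : am1 = 0 := by simpa using hα 0 (by omega)
  refine ⟨by rw [ham2, ham1, mul_zero], ham1, fun k hk => ?_, fun k hk => ?_⟩
  · rcases Nat.eq_zero_or_pos k with rfl | hk0
    · exact hα0
    · simpa [hk0.ne'] using hα k (by omega)
  · simpa using hβ k (by omega)

theorem polyPart_add_algLog_eq (n : ℕ) (am2 am1 : ℝ) (α β : ℕ → ℝ) (γ0 γ1 : ℝ) {h : ℝ}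
    (hh : 0 < h) :
    (polyPart n am2 am1 α β).eval (√(h * (4 + h)) / 2)
        + algLog (2 * am2 - 8 * am1 + 24 * α 0) (8 * α 0) (2 * γ0) (8 * γ1) (√(h * (4 + h)) / 2) =
      h * (am2 + am1 * h + α 0 * h ^ 2)
        + h * (4 + h) * (∑ i ∈ Finset.Icc 1 (n - 2), α i * (2 + h) ^ (2 * i))
        + √(h * (4 + h)) * (∑ i ∈ Finset.range n, β i * (2 + h) ^ (2 * i))
        + (2 + h) * (γ0 + γ1 * (2 + h) ^ 2) * log ((2 + h + √(h * (4 + h))) / 2) := by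
  have hs : √(h * (4 + h)) ^ 2 = h * (4 + h) := sq_sqrt (by positivity)
  have hy : 1 + (√(h * (4 + h)) / 2) ^ 2 = ((2 + h) / 2) ^ 2 := by rw [div_pow, hs]; ring
  have hX : √(1 + (√(h * (4 + h)) / 2) ^ 2) = (2 + h) / 2 := by
    rw [hy, sqrt_sq (by positivity)]
  have hL : arsinh (√(h * (4 + h)) / 2) = log ((2 + h + √(h * (4 + h))) / 2) := by
    rw [arsinh, hX]; congr 1; ring
  have hpow (i : ℕ) (c : ℝ) : c * 4 ^ i * (((2 + h) / 2) ^ 2) ^ i = c * (2 + h) ^ (2 * i) := by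
    rw [mul_assoc, ← mul_pow, pow_mul]
    congr 2
    ring
  rw [eval_polyPart, algLog, hX, hL, hy]
  simp only [hpow]
  linear_combination (∑ i ∈ Finset.Icc 1 (n - 2), α i * (2 + h) ^ (2 * i)) * hs

/-- Let `n ≥ 3` and let `α_{−2}, α_{−1}, α_0, …, α_{n−2}`,
`β_0, …, β_{n−1}`, `γ_0, γ_1` be reals, not all zero, with `γ_1 = 0` when `n ∈ {3,4}`.
Then
`F(h) = h(α_{−2} + α_{−1} h + α_0 h²) + h(4+h) Σ_{i=1}^{n−2} α_i (2+h)^{2i}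
  + √(h(4+h)) Σ_{i=0}^{n−1} β_i (2+h)^{2i}
  + (2+h)(γ_0 + γ_1 (2+h)²) ln((2 + h + √(h(4+h)))/2)`
has at most `2n+2` zeros in `(0,∞)`. -/
theorem stmt15 (n : ℕ) (hn : 3 ≤ n) (am2 am1 : ℝ) (α β : ℕ → ℝ) (γ0 γ1 : ℝ)
    (hγ1 : (n = 3 ∨ n = 4) → γ1 = 0)
    (hne : ¬ (am2 = 0 ∧ am1 = 0 ∧ (∀ k ≤ n - 2, α k = 0) ∧
      (∀ k ≤ n - 1, β k = 0) ∧ γ0 = 0 ∧ γ1 = 0)) :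
    ∀ T : Finset ℝ,
      (∀ h ∈ T, h ∈ Set.Ioi (0 : ℝ) ∧
        h * (am2 + am1 * h + α 0 * h ^ 2)
          + h * (4 + h) * (∑ i ∈ Finset.Icc 1 (n - 2), α i * (2 + h) ^ (2 * i))
          + Real.sqrt (h * (4 + h)) * (∑ i ∈ Finset.range n, β i * (2 + h) ^ (2 * i))
          + (2 + h) * (γ0 + γ1 * (2 + h) ^ 2) *
              Real.log ((2 + h + Real.sqrt (h * (4 + h))) / 2) = 0) →
      T.card ≤ 2 * n + 2 := by
  intro T hT
  have hpos (h : ℝ) (hh : h ∈ T) : 0 < √(h * (4 + h)) / 2 := by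
    have : 0 < h := (hT h hh).1
    positivity
  have hinj : Set.InjOn (fun h => √(h * (4 + h)) / 2) T := by
    intro h hh k hk heq
    have h0 : 0 < h := (hT h hh).1
    have k0 : 0 < k := (hT k hk).1
    have : √(h * (4 + h)) = √(k * (4 + k)) := by simpa using heq
    rw [sqrt_inj (by positivity) (by positivity)] at this
    nlinarith
  have hnotMem : 0 ∉ T.image fun h => √(h * (4 + h)) / 2 := by
    intro h0
    obtain ⟨h, hh, h0⟩ := Finset.mem_image.1 h0
    exact (hpos h hh).ne' h0
  have hdeg := natDegree_polyPart_lt (by omega : 2 ≤ n) am2 am1 α β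
  have := card_zeros_algLog_lt (Q := polyPart n am2 am1 α β)
    (a := 2 * am2 - 8 * am1 + 24 * α 0) (b := 8 * α 0) (c := 2 * γ0) (d := 8 * γ1)
    (K := 2 * n - 4) (by omega) (by
      rintro ⟨hQ, ha, hb, hc, hd⟩
      obtain ⟨h1, h2, h3, h4⟩ :=
        coeff_eq_zero_of_polyPart_eq_zero (by omega) hQ (by linarith) ha
      exact hne ⟨h1, h2, h3, h4, by linarith, by linarith⟩)
    (insert 0 (T.image fun h => √(h * (4 + h)) / 2)) (by
      intro y hy
      rcases Finset.mem_insert.1 hy with rfl | hy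
      · refine ⟨le_rfl, ?_⟩
        simp only [eval_polyPart, algLog, arsinh_zero]
        norm_num
        ring
      · obtain ⟨h, hh, rfl⟩ := Finset.mem_image.1 hy
        exact ⟨(hpos h hh).le, by
          rw [polyPart_add_algLog_eq n am2 am1 α β γ0 γ1 (hT h hh).1, (hT h hh).2]⟩)
  rw [Finset.card_insert_of_notMem hnotMem, Finset.card_image_of_injOn hinj] at this
  omega
end

section
/- Any nontrivial real linear combination of the four functions f₁(h) = h, f₂(h) = h(4+h)(2+h), f₃(h) = √(h(4+h)) and f₄(h) = √(h(4+h))(2+h)² has at most 3 zeros in (0,∞); equivalently, (f₁, f₂, f₃, f₄) is an extended complete Chebyshev system on (0,∞). -/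
open Real

/-- A real cubic with four distinct roots vanishes identically. -/
lemma cubic_coeffs_eq_zero {c₀ c₁ c₂ c₃ x y z w : ℝ}
    (hxy : x ≠ y) (hxz : x ≠ z) (hxw : x ≠ w) (hyz : y ≠ z) (hyw : y ≠ w) (hzw : z ≠ w)
    (hx : c₃ * x ^ 3 + c₂ * x ^ 2 + c₁ * x + c₀ = 0)
    (hy : c₃ * y ^ 3 + c₂ * y ^ 2 + c₁ * y + c₀ = 0)
    (hz : c₃ * z ^ 3 + c₂ * z ^ 2 + c₁ * z + c₀ = 0)
    (hw : c₃ * w ^ 3 + c₂ * w ^ 2 + c₁ * w + c₀ = 0) :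
    c₀ = 0 ∧ c₁ = 0 ∧ c₂ = 0 ∧ c₃ = 0 := by
  have key : ∀ t, x ≠ t → c₃ * t ^ 3 + c₂ * t ^ 2 + c₁ * t + c₀ = 0 →
      c₃ * (x ^ 2 + x * t + t ^ 2) + c₂ * (x + t) + c₁ = 0 := fun t hxt ht ↦
    mul_left_cancel₀ (sub_ne_zero.2 hxt) (by linear_combination hx - ht)
  have ky := key y hxy hy
  have kz := key z hxz hz
  have kw := key w hxw hw
  have mz : c₃ * (x + y + z) + c₂ = 0 :=
    mul_left_cancel₀ (sub_ne_zero.2 hyz) (by linear_combination ky - kz)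
  have mw : c₃ * (x + y + w) + c₂ = 0 :=
    mul_left_cancel₀ (sub_ne_zero.2 hyw) (by linear_combination ky - kw)
  have h₃ : c₃ = 0 :=
    mul_left_cancel₀ (sub_ne_zero.2 hzw) (by linear_combination mz - mw)
  subst h₃
  have h₂ : c₂ = 0 := by linarith
  subst h₂
  have h₁ : c₁ = 0 := by linarith
  subst h₁
  exact ⟨by linarith, rfl, rfl, rfl⟩

/-- A real quintic of the form `a (X⁵ + X⁴) + b X³ + c X² + d (X + 1)` with four distinct positive
roots vanishes identically. -/
lemma quintic_coeffs_eq_zero {a b c d x y z w : ℝ}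
    (hx₀ : 0 < x) (hy₀ : 0 < y) (hz₀ : 0 < z) (hw₀ : 0 < w)
    (hxy : x ≠ y) (hxz : x ≠ z) (hxw : x ≠ w) (hyz : y ≠ z) (hyw : y ≠ w) (hzw : z ≠ w)
    (hx : a * (x ^ 5 + x ^ 4) + b * x ^ 3 + c * x ^ 2 + d * (x + 1) = 0)
    (hy : a * (y ^ 5 + y ^ 4) + b * y ^ 3 + c * y ^ 2 + d * (y + 1) = 0)
    (hz : a * (z ^ 5 + z ^ 4) + b * z ^ 3 + c * z ^ 2 + d * (z + 1) = 0)
    (hw : a * (w ^ 5 + w ^ 4) + b * w ^ 3 + c * w ^ 2 + d * (w + 1) = 0) :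
    a = 0 ∧ b = 0 ∧ c = 0 ∧ d = 0 := by
  obtain ⟨e₁, he₁⟩ : ∃ e, e = x + y + z + w := ⟨_, rfl⟩
  obtain ⟨e₂, he₂⟩ : ∃ e, e = x * y + x * z + x * w + y * z + y * w + z * w := ⟨_, rfl⟩
  obtain ⟨e₃, he₃⟩ : ∃ e, e = x * y * z + x * y * w + x * z * w + y * z * w := ⟨_, rfl⟩
  obtain ⟨e₄, he₄⟩ : ∃ e, e = x * y * z * w := ⟨_, rfl⟩
  have p₁ : 0 < e₁ := by rw [he₁]; positivity
  have p₃ : 0 < e₃ := by rw [he₃]; positivity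
  have p₄ : 0 < e₄ := by rw [he₄]; positivity
  have rx : x ^ 4 - e₁ * x ^ 3 + e₂ * x ^ 2 - e₃ * x + e₄ = 0 := by
    rw [he₁, he₂, he₃, he₄]; ring
  have ry : y ^ 4 - e₁ * y ^ 3 + e₂ * y ^ 2 - e₃ * y + e₄ = 0 := by
    rw [he₁, he₂, he₃, he₄]; ring
  have rz : z ^ 4 - e₁ * z ^ 3 + e₂ * z ^ 2 - e₃ * z + e₄ = 0 := by
    rw [he₁, he₂, he₃, he₄]; ring
  have rw' : w ^ 4 - e₁ * w ^ 3 + e₂ * w ^ 2 - e₃ * w + e₄ = 0 := by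
    rw [he₁, he₂, he₃, he₄]; ring
  -- the remainder of the quintic modulo the monic quartic with these roots
  obtain ⟨h₀, h₁, h₂, h₃⟩ := cubic_coeffs_eq_zero
    (c₀ := d - a * (1 + e₁) * e₄) (c₁ := d - a * e₄ + a * (1 + e₁) * e₃)
    (c₂ := c + a * e₃ - a * (1 + e₁) * e₂) (c₃ := b - a * e₂ + a * (1 + e₁) * e₁)
    hxy hxz hxw hyz hyw hzw
    (by linear_combination hx - (a * x + a * (1 + e₁)) * rx)
    (by linear_combination hy - (a * y + a * (1 + e₁)) * ry)
    (by linear_combination hz - (a * z + a * (1 + e₁)) * rz)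
    (by linear_combination hw - (a * w + a * (1 + e₁)) * rw')
  have hpos : 0 < e₁ * e₄ + (1 + e₁) * e₃ := by positivity
  have ha : a = 0 := mul_right_cancel₀ hpos.ne' (by linear_combination h₁ - h₀)
  subst ha
  exact ⟨rfl, by linarith, by linarith, by linarith⟩

/-- The curve `s = √(h(4+h))`, `h > 0`, is rationally parametrized by `x > 1`. -/
lemma exists_param_sqrt_mul_four_add {h : ℝ} (hh : 0 < h) :
    ∃ x : ℝ, 1 < x ∧ h = (x - 1) ^ 2 / x ∧ √(h * (4 + h)) = (x ^ 2 - 1) / x := by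
  have hs : √(h * (4 + h)) ^ 2 = h * (4 + h) := Real.sq_sqrt (by positivity)
  have hs₀ : 0 ≤ √(h * (4 + h)) := Real.sqrt_nonneg _
  set s := √(h * (4 + h))
  have hx : 1 < (h + 2 + s) / 2 := by linarith
  refine ⟨(h + 2 + s) / 2, hx, ?_, ?_⟩
  · rw [eq_div_iff (by linarith)]
    linear_combination -hs / 4
  · rw [eq_div_iff (by linarith)]
    linear_combination hs / 4

theorem stmt16 (l1 l2 l3 l4 : ℝ) (hne : ¬ (l1 = 0 ∧ l2 = 0 ∧ l3 = 0 ∧ l4 = 0)) :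
    ∀ T : Finset ℝ,
      (∀ h ∈ T, h ∈ Set.Ioi (0 : ℝ) ∧
        l1 * h + l2 * (h * (4 + h) * (2 + h)) + l3 * Real.sqrt (h * (4 + h))
          + l4 * (Real.sqrt (h * (4 + h)) * (2 + h) ^ 2) = 0) →
      T.card ≤ 3 := by
  intro T hT
  by_contra! hcard
  have key : ∀ h ∈ T, ∃ x : ℝ, 0 < x ∧ h = (x - 1) ^ 2 / x ∧
      (l2 + l4) * (x ^ 5 + x ^ 4) + (l1 + l3 + 2 * l4) * x ^ 3
        + (-l1 + l3 + 2 * l4) * x ^ 2 + (l4 - l2) * (x + 1) = 0 := by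
    intro h hh
    obtain ⟨hpos, heq⟩ := hT h hh
    obtain ⟨x, hx, hhx, hsx⟩ := exists_param_sqrt_mul_four_add hpos
    have hx₀ : x ≠ 0 := by linarith
    refine ⟨x, by linarith, hhx, mul_left_cancel₀ (sub_ne_zero.2 hx.ne') ?_⟩
    rw [hsx, hhx] at heq
    field_simp at heq
    linear_combination heq
  obtain ⟨S, hST, hS⟩ := Finset.exists_subset_card_eq (show 4 ≤ T.card from hcard)
  obtain ⟨p, q, r, t, hpq, hpr, hpt, hqr, hqt, hrt, rfl⟩ := Finset.card_eq_four.1 hS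
  obtain ⟨x, hx₀, rfl, hx⟩ := key p (hST (by simp))
  obtain ⟨y, hy₀, rfl, hy⟩ := key q (hST (by simp))
  obtain ⟨z, hz₀, rfl, hz⟩ := key r (hST (by simp))
  obtain ⟨w, hw₀, rfl, hw⟩ := key t (hST (by simp))
  obtain ⟨ha, hb, hc, hd⟩ := quintic_coeffs_eq_zero hx₀ hy₀ hz₀ hw₀
    (by rintro rfl; exact hpq rfl) (by rintro rfl; exact hpr rfl) (by rintro rfl; exact hpt rfl)
    (by rintro rfl; exact hqr rfl) (by rintro rfl; exact hqt rfl) (by rintro rfl; exact hrt rfl)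
    hx hy hz hw
  exact hne ⟨by linarith, by linarith, by linarith, by linarith⟩
end
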